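/- arXiv:2405.16556 — 4 statements merged into one kernel-verified Lean document; each statement's English description precedes it below -/
import Mathlib

section
/- (Proposition 1.) Let g(X) = −β·X^α with β > 0 and α > 1, and set X₀ = 5B̃/Ã. If g′(X₀) > f′(X₀), i.e. −αβ·X₀^{α−1} > −(Ã/5)·(Ã/(5B̃))^{3/2}, then the M-Köhler curve f − g has at least a local maximum and a local minimum on (0,∞): there exist points a, b with 0 < a < X₀ < b such that f − g has a local maximum at a and a local minimum at b. -/
open Real Filter Set Topology

/-- If `f' a < 0 < f' b`, then `f` has a local minimum strictly between `a` and `b`. -/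
theorem exists_isLocalMin_mem_Ioo_of_deriv_neg_pos {f f' : ℝ → ℝ} {a b : ℝ} (hab : a < b)
    (hf : ∀ x ∈ Icc a b, HasDerivAt f (f' x) x) (ha : f' a < 0) (hb : 0 < f' b) :
    ∃ c ∈ Ioo a b, IsLocalMin f c := by
  obtain ⟨c, hc, hmin⟩ := isCompact_Icc.exists_isMinOn (nonempty_Icc.2 hab.le)
    fun x hx => (hf x hx).continuousAt.continuousWithinAt
  have key : ∀ y ∈ Icc a b, 0 ≤ (y - c) * f' c := fun y hy => by
    have hy' : y - c ∈ posTangentConeAt (Icc a b) c :=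
      sub_mem_posTangentConeAt_of_segment_subset ((convex_Icc a b).segment_subset hc hy)
    simpa using
      hmin.localize.hasFDerivWithinAt_nonneg (hf c hc).hasDerivWithinAt.hasFDerivWithinAt hy'
  have hac : a < c := by
    rcases hc.1.eq_or_lt with rfl | h
    · nlinarith [key b (right_mem_Icc.2 hab.le)]
    · exact h
  have hcb : c < b := by
    rcases hc.2.eq_or_lt with rfl | h
    · nlinarith [key a (left_mem_Icc.2 hab.le)]
    · exact h
  exact ⟨c, ⟨hac, hcb⟩, hmin.isLocalMin (Icc_mem_nhds hac hcb)⟩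

/-- If `f' b < 0 < f' a`, then `f` has a local maximum strictly between `a` and `b`. -/
theorem exists_isLocalMax_mem_Ioo_of_deriv_pos_neg {f f' : ℝ → ℝ} {a b : ℝ} (hab : a < b)
    (hf : ∀ x ∈ Icc a b, HasDerivAt f (f' x) x) (ha : 0 < f' a) (hb : f' b < 0) :
    ∃ c ∈ Ioo a b, IsLocalMax f c := by
  obtain ⟨c, hc, hmin⟩ := exists_isLocalMin_mem_Ioo_of_deriv_neg_pos (f := fun x => -f x)
    (f' := fun x => -f' x) hab (fun x hx => (hf x hx).fun_neg) (by linarith) (by linarith)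
  exact ⟨c, hc, by simpa using hmin.neg⟩

/-- The derivative of the M-Köhler curve. -/
theorem hasDerivAt_mkohler (A B β α : ℝ) {X : ℝ} (hX : 0 < X) :
    HasDerivAt (fun X : ℝ => A * X ^ (-(1 : ℝ) / 2) - B * X ^ (-(3 : ℝ) / 2) - -β * X ^ α)
      (X ^ (-(3 : ℝ) / 2) * (3 / 2 * (B / X) - A / 2) + α * β * X ^ (α - 1)) X := by
  have h (p : ℝ) := Real.hasDerivAt_rpow_const (x := X) (p := p) (Or.inl hX.ne')
  refine ((((h _).const_mul A).sub ((h _).const_mul B)).sub ((h α).const_mul (-β))).congr_deriv ?_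
  rw [Real.rpow_sub_one hX.ne' (-(3 : ℝ) / 2), show -(1 : ℝ) / 2 - 1 = -3 / 2 by norm_num]
  ring

/-- Proposition 1: Let `g(X) = −β·X^α` with `β > 0` and `α > 1`, and set
`X₀ = 5B̃/Ã`. If `g′(X₀) > f′(X₀)`, i.e. `−αβ·X₀^{α−1} > −(Ã/5)·(Ã/(5B̃))^{3/2}`, then
the M-Köhler curve `f − g` has at least a local maximum and a local minimum on `(0,∞)`:
there exist points `a, b` with `0 < a < X₀ < b` such that `f − g` has a local maximum at
`a` and a local minimum at `b`. -/
theorem mkohler_multistability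
    (A B D β α : ℝ) (hA : 0 < A) (hB : 0 < B) (hD : 0 < D)
    (hβ : 0 < β) (hα : 1 < α)
    (Atil Btil : ℝ)
    (hAtil : Atil = A / (2 * D) ^ ((1 : ℝ) / 2))
    (hBtil : Btil = B / (2 * D) ^ ((3 : ℝ) / 2))
    (f g F : ℝ → ℝ)
    (hf : ∀ X : ℝ, f X = Atil * X ^ (-(1 : ℝ) / 2) - Btil * X ^ (-(3 : ℝ) / 2))
    (hg : ∀ X : ℝ, g X = -β * X ^ α)
    (hF : ∀ X : ℝ, F X = f X - g X)
    (hcond : -(α * β) * (5 * Btil / Atil) ^ (α - 1) >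
        -(Atil / 5) * (Atil / (5 * Btil)) ^ ((3 : ℝ) / 2)) :
    ∃ a b : ℝ, 0 < a ∧ a < 5 * Btil / Atil ∧ 5 * Btil / Atil < b ∧
      IsLocalMax F a ∧ IsLocalMin F b := by
  have hA' : 0 < Atil := hAtil ▸ by positivity
  have hB' : 0 < Btil := hBtil ▸ by positivity
  have hα0 : 0 < α := by linarith
  clear hAtil hBtil
  obtain rfl : F = fun X : ℝ =>
      Atil * X ^ (-(1 : ℝ) / 2) - Btil * X ^ (-(3 : ℝ) / 2) - -β * X ^ α := by
    funext X
    rw [hF, hf, hg]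
  have hX₀ : 0 < 5 * Btil / Atil := by positivity
  have hder := fun (X : ℝ) (hX : 0 < X) => hasDerivAt_mkohler Atil Btil β α hX
  have hneg : (5 * Btil / Atil) ^ (-(3 : ℝ) / 2) * (3 / 2 * (Btil / (5 * Btil / Atil)) - Atil / 2)
      + α * β * (5 * Btil / Atil) ^ (α - 1) < 0 := by
    have hpow : (5 * Btil / Atil) ^ (-(3 : ℝ) / 2) = (Atil / (5 * Btil)) ^ ((3 : ℝ) / 2) := by
      rw [neg_div, Real.rpow_neg hX₀.le, ← Real.inv_rpow hX₀.le, inv_div]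
    have hdiv : Btil / (5 * Btil / Atil) = Atil / 5 := by field_simp
    rw [hpow, hdiv]
    linarith
  have hpos : 0 < (Btil / Atil) ^ (-(3 : ℝ) / 2) * (3 / 2 * (Btil / (Btil / Atil)) - Atil / 2)
      + α * β * (Btil / Atil) ^ (α - 1) := by
    have hdiv : 3 / 2 * (Btil / (Btil / Atil)) - Atil / 2 = Atil := by
      field_simp
      norm_num
    rw [hdiv]
    positivity
  obtain ⟨Y, hY, hY₀, hY₁⟩ : ∃ Y : ℝ, Atil / (2 * (α * β)) < Y ^ (α - 1) ∧
      5 * Btil / Atil < Y ∧ 1 ≤ Y :=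
    (((tendsto_rpow_atTop (sub_pos.2 hα)).eventually_gt_atTop _).and
      ((eventually_gt_atTop _).and (eventually_ge_atTop _))).exists
  have hYpos : 0 < Y ^ (-(3 : ℝ) / 2) * (3 / 2 * (Btil / Y) - Atil / 2)
      + α * β * Y ^ (α - 1) := by
    have hle : Y ^ (-(3 : ℝ) / 2) ≤ 1 := Real.rpow_le_one_of_one_le_of_nonpos hY₁ (by norm_num)
    have hnonneg : 0 ≤ Y ^ (-(3 : ℝ) / 2) * (Btil / Y) := by positivity
    rw [div_lt_iff₀ (by positivity)] at hY
    nlinarith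
  have hlt : Btil / Atil < 5 * Btil / Atil := by
    gcongr
    linarith
  obtain ⟨a, ha, hmax⟩ := exists_isLocalMax_mem_Ioo_of_deriv_pos_neg hlt
    (fun x hx => hder x ((div_pos hB' hA').trans_le hx.1)) hpos hneg
  obtain ⟨b, hb, hmin⟩ := exists_isLocalMin_mem_Ioo_of_deriv_neg_pos hY₀
    (fun x hx => hder x (hX₀.trans_le hx.1)) hneg hYpos
  exact ⟨a, b, (div_pos hB' hA').trans ha.1, ha.2, hb.1, hmax, hmin⟩
end

section
/- If β > 0 satisfies (3/2)·β·(5B̃/Ã)^{1/2} < (Ã/5)·(Ã/(5B̃))^{3/2}, then the depressed cubic equation −3β·X³ + Ã·X − 3B̃ = 0 has at least two distinct positive solutions. -/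
open Real Filter Set Topology

/-- A depressed cubic with negative leading and constant coefficients that is positive at some
positive point has two distinct positive roots. -/
lemma exists_two_pos_roots_of_cubic_pos {p q r x : ℝ} (hp : 0 < p) (hr : 0 < r) (hx : 0 < x)
    (hpos : 0 < -p * x ^ 3 + q * x - r) :
    ∃ X₁ X₂ : ℝ, 0 < X₁ ∧ 0 < X₂ ∧ X₁ ≠ X₂ ∧
      -p * X₁ ^ 3 + q * X₁ - r = 0 ∧ -p * X₂ ^ 3 + q * X₂ - r = 0 := by
  have hcont : Continuous fun X : ℝ => -p * X ^ 3 + q * X - r := by fun_prop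
  have hM : ∃ M, x ≤ M ∧ -p * M ^ 3 + q * M - r < 0 := by
    refine ⟨x + 1 + |q| / p, by linarith [show 0 ≤ |q| / p by positivity], ?_⟩
    set M := x + 1 + |q| / p with hMdef
    have hM1 : 1 ≤ M := by linarith [show 0 ≤ |q| / p by positivity]
    have hpM : q ≤ p * M := by
      have : p * M = p * (x + 1) + |q| := by rw [hMdef]; field_simp
      nlinarith [le_abs_self q]
    have hpM2 : q ≤ p * M ^ 2 := by nlinarith [mul_pos hp (zero_lt_one.trans_le hM1)]
    nlinarith
  obtain ⟨M, hxM, hneg⟩ := hM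
  obtain ⟨X₁, ⟨h₁, h₁x⟩, hX₁⟩ := intermediate_value_Ioo hx.le hcont.continuousOn
    (show (0 : ℝ) ∈ Ioo _ _ from ⟨by simpa using hr, hpos⟩)
  obtain ⟨X₂, ⟨h₂, -⟩, hX₂⟩ := intermediate_value_Ioo' hxM hcont.continuousOn
    (show (0 : ℝ) ∈ Ioo _ _ from ⟨hneg, hpos⟩)
  exact ⟨X₁, X₂, h₁, hx.trans h₂, (h₁x.trans h₂).ne, hX₁, hX₂⟩

/-- If `β > 0` satisfies `(3/2)·β·(5B̃/Ã)^{1/2} < (Ã/5)·(Ã/(5B̃))^{3/2}`,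
then the depressed cubic equation `−3β·X³ + Ã·X − 3B̃ = 0` has at least two distinct
positive solutions. -/
theorem cubic_two_positive_roots
    (A B D β : ℝ) (hA : 0 < A) (hB : 0 < B) (hD : 0 < D) (hβ : 0 < β)
    (Atil Btil : ℝ)
    (hAtil : Atil = A / (2 * D) ^ ((1 : ℝ) / 2))
    (hBtil : Btil = B / (2 * D) ^ ((3 : ℝ) / 2))
    (hcond : 3 / 2 * β * (5 * Btil / Atil) ^ ((1 : ℝ) / 2) <
        Atil / 5 * (Atil / (5 * Btil)) ^ ((3 : ℝ) / 2)) :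
    ∃ X₁ X₂ : ℝ, 0 < X₁ ∧ 0 < X₂ ∧ X₁ ≠ X₂ ∧
      -3 * β * X₁ ^ 3 + Atil * X₁ - 3 * Btil = 0 ∧
      -3 * β * X₂ ^ 3 + Atil * X₂ - 3 * Btil = 0 := by
  have ha : 0 < Atil := by rw [hAtil]; positivity
  have hb : 0 < Btil := by rw [hBtil]; positivity
  obtain ⟨x, hx⟩ : ∃ x, x = 5 * Btil / Atil := ⟨_, rfl⟩
  have hx0 : 0 < x := by rw [hx]; positivity
  have hax : Btil = Atil * x / 5 := by rw [hx]; field_simp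
  have hinv : Atil / (5 * Btil) = x⁻¹ := by rw [hx, inv_div]
  rw [hinv, ← hx, inv_rpow hx0.le, ← div_eq_mul_inv, lt_div_iff₀ (by positivity), mul_assoc,
    ← rpow_add hx0, show (1 : ℝ) / 2 + 3 / 2 = (2 : ℕ) by norm_num, rpow_natCast] at hcond
  have hpos : 0 < -(3 * β) * x ^ 3 + Atil * x - 3 * Btil := by
    rw [hax]
    nlinarith [mul_pos hx0 (sub_pos.2 hcond)]
  simpa only [neg_mul] using
    exists_two_pos_roots_of_cubic_pos (by positivity) (by positivity) hx0 hpos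
end

section
/- Multistability of the M-Köhler equation: with g(X) = −β·X^α, β > 0 and α > 0, one has (f−g)(X) → −∞ as X → 0⁺ and (f−g)(X) → +∞ as X → ∞; consequently, for any λ ∈ ℝ, if there exist 0 < a < b with (f−g)(a) > λ and (f−g)(b) < λ, then the equation λ = (f−g)(X) has at least three solutions in (0,∞): a haze equilibrium X_h ∈ (0, a), an unstable equilibrium X_u ∈ (a, b), and an activated equilibrium X_c ∈ (b, ∞). -/
open Real Filter Set Topology

/-- On `(0, ∞)` a Köhler-type curve with a power-law term tends to `-∞` at the origin. -/
theorem tendsto_kohler_nhdsGT_zero (p β : ℝ) {q α : ℝ} (hq : 0 < q) (hα : 0 < α) :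
    Tendsto (fun X : ℝ => p * X ^ (-(1 : ℝ) / 2) - q * X ^ (-(3 : ℝ) / 2) + β * X ^ α)
      (𝓝[>] 0) atBot := by
  have hid : Tendsto (fun X : ℝ => X) (𝓝[>] 0) (𝓝 0) := tendsto_nhdsWithin_of_tendsto_nhds tendsto_id
  have hpow : Tendsto (fun X : ℝ => X ^ α) (𝓝[>] 0) (𝓝 0) := by
    simpa [Real.zero_rpow hα.ne'] using hid.rpow_const (p := α) (Or.inr hα.le)
  have hlin : Tendsto (fun X : ℝ => p * X - q) (𝓝[>] 0) (𝓝 (-q)) := by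
    simpa using (hid.const_mul p).sub_const q
  have htop : Tendsto (fun X : ℝ => X ^ (-(3 : ℝ) / 2)) (𝓝[>] 0) atTop :=
    tendsto_rpow_neg_nhdsGT_zero (by norm_num)
  refine ((htop.atTop_mul_neg (neg_lt_zero.mpr hq) hlin).atBot_add
    (hpow.const_mul β)).congr' ?_
  filter_upwards [self_mem_nhdsWithin] with X hX
  have hX : 0 < X := hX
  have : X ^ (-(1 : ℝ) / 2) = X ^ (-(3 : ℝ) / 2) * X := by
    rw [← Real.rpow_add_one hX.ne']; norm_num
  rw [this]; ring

/-- A Köhler-type curve with a positive power-law term tends to `∞` at infinity. -/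
theorem tendsto_kohler_atTop (p q : ℝ) {β α : ℝ} (hβ : 0 < β) (hα : 0 < α) :
    Tendsto (fun X : ℝ => p * X ^ (-(1 : ℝ) / 2) - q * X ^ (-(3 : ℝ) / 2) + β * X ^ α)
      atTop atTop := by
  have h (s : ℝ) (hs : 0 < s) : Tendsto (fun X : ℝ => X ^ (-s / 2)) atTop (𝓝 0) := by
    simpa [neg_div] using tendsto_rpow_neg_atTop (half_pos hs)
  exact (((h 1 one_pos).const_mul p).sub ((h 3 three_pos).const_mul q)).add_atTop
    ((tendsto_rpow_atTop hα).const_mul_atTop hβ)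

/-- A Köhler-type curve with a power-law term is continuous on `(0, ∞)`. -/
theorem continuousOn_kohler (p q β α : ℝ) :
    ContinuousOn (fun X : ℝ => p * X ^ (-(1 : ℝ) / 2) - q * X ^ (-(3 : ℝ) / 2) + β * X ^ α)
      (Ioi 0) := by
  have h (s : ℝ) : ContinuousOn (fun X : ℝ => X ^ s) (Ioi 0) :=
    continuousOn_id.rpow_const fun X hX => Or.inl (ne_of_gt hX)
  exact (((h _).const_mul p).sub ((h _).const_mul q)).add ((h _).const_mul β)

/-- A function continuous on `(0, ∞)`, tending to `-∞` at `0` and to `∞` at `∞`, that lies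
above `c` at `a` and below `c` at `b > a` takes the value `c` at least three times. -/
theorem exists_three_solutions {F : ℝ → ℝ} (hF : ContinuousOn F (Ioi 0))
    (hzero : Tendsto F (𝓝[>] 0) atBot) (htop : Tendsto F atTop atTop)
    {c a b : ℝ} (ha : 0 < a) (hab : a < b) (hca : c < F a) (hcb : F b < c) :
    ∃ x y z : ℝ, x ∈ Ioo 0 a ∧ y ∈ Ioo a b ∧ z ∈ Ioi b ∧ F x = c ∧ F y = c ∧ F z = c := by
  obtain ⟨u, hu, hu0, hua⟩ :=
    ((hzero.eventually_lt_atBot c).and (Ioo_mem_nhdsGT ha)).exists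
  obtain ⟨v, hv, hbv⟩ :=
    ((htop.eventually_gt_atTop c).and (eventually_gt_atTop b)).exists
  have hcont {l r : ℝ} (hl : 0 < l) : ContinuousOn F (Icc l r) :=
    hF.mono fun x hx => hl.trans_le hx.1
  obtain ⟨x, hx, hxc⟩ := intermediate_value_Ioo hua.le (hcont hu0) ⟨hu, hca⟩
  obtain ⟨y, hy, hyc⟩ := intermediate_value_Ioo' hab.le (hcont ha) ⟨hcb, hca⟩
  obtain ⟨z, hz, hzc⟩ := intermediate_value_Ioo hbv.le (hcont (ha.trans hab)) ⟨hcb, hv⟩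
  exact ⟨x, y, z, ⟨hu0.trans hx.1, hx.2⟩, hy, hz.1, hxc, hyc, hzc⟩

/-- Multistability of the M-Köhler equation: with `g(X) = −β·X^α`, `β > 0`
and `α > 0`, one has `(f−g)(X) → −∞` as `X → 0⁺` and `(f−g)(X) → +∞` as `X → ∞`;
consequently, for any `λ ∈ ℝ`, if there exist `0 < a < b` with `(f−g)(a) > λ` and
`(f−g)(b) < λ`, then the equation `λ = (f−g)(X)` has at least three solutions in `(0,∞)`:
a haze equilibrium `X_h ∈ (0, a)`, an unstable equilibrium `X_u ∈ (a, b)`, and an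
activated equilibrium `X_c ∈ (b, ∞)`. -/
theorem mkohler_three_equilibria
    (A B D β α : ℝ) (hA : 0 < A) (hB : 0 < B) (hD : 0 < D)
    (hβ : 0 < β) (hα : 0 < α)
    (Atil Btil : ℝ)
    (hAtil : Atil = A / (2 * D) ^ ((1 : ℝ) / 2))
    (hBtil : Btil = B / (2 * D) ^ ((3 : ℝ) / 2))
    (f g F : ℝ → ℝ)
    (hf : ∀ X : ℝ, f X = Atil * X ^ (-(1 : ℝ) / 2) - Btil * X ^ (-(3 : ℝ) / 2))
    (hg : ∀ X : ℝ, g X = -β * X ^ α)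
    (hF : ∀ X : ℝ, F X = f X - g X) :
    Filter.Tendsto F (nhdsWithin 0 (Set.Ioi 0)) Filter.atBot ∧
      Filter.Tendsto F Filter.atTop Filter.atTop ∧
      ∀ lam a b : ℝ, 0 < a → a < b → lam < F a → F b < lam →
        ∃ Xh Xu Xc : ℝ, Xh ∈ Set.Ioo 0 a ∧ Xu ∈ Set.Ioo a b ∧ Xc ∈ Set.Ioi b ∧
          F Xh = lam ∧ F Xu = lam ∧ F Xc = lam := by
  have hq : 0 < Btil := by rw [hBtil]; positivity
  obtain rfl : F = fun X => Atil * X ^ (-(1 : ℝ) / 2) - Btil * X ^ (-(3 : ℝ) / 2) + β * X ^ α := by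
    funext X
    rw [hF, hf, hg]
    ring
  have hzero := tendsto_kohler_nhdsGT_zero Atil β hq hα
  have htop := tendsto_kohler_atTop Atil Btil hβ hα
  exact ⟨hzero, htop, fun lam a b ha hab hla hlb =>
    exists_three_solutions (continuousOn_kohler Atil Btil β α) hzero htop ha hab hla hlb⟩
end

section
/- Normalizability of the Gibbs state for the M-Köhler model with bounded state-dependent noise: let f(X) = Ã·X^{-1/2} − B̃·X^{-3/2}, g(X) = −β·X^α with β > 0 and α > 0, λ ∈ ℝ, fix x₀ > 0, and let σ : (0,∞) → ℝ be continuous with 0 < σ₁ ≤ σ(X) ≤ σ₂ for all X > 0 and some constants σ₁, σ₂. Then the Gibbs density ρ_λ(X) = σ(X)^{-2} · exp(2∫_{x₀}^X (λ − f(s) + g(s))/σ(s)² ds) is integrable on (0,∞), so the normalizing constant Z_λ = ∫₀^∞ σ(X)^{-2} exp(2∫_{x₀}^X (λ − f(s) + g(s))/σ(s)² ds) dX is finite. -/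
open Real Filter Set Topology MeasureTheory intervalIntegral

/-- If `h` is continuous on `(0, ∞)`, nonnegative near `0` and bounded above by a negative constant
near `∞`, then the exponential of twice its primitive is integrable on `(0, ∞)`. -/
lemma integrableOn_exp_two_mul_primitive {h : ℝ → ℝ} {x₀ : ℝ} (hx₀ : 0 < x₀)
    (hcont : ContinuousOn h (Set.Ioi 0)) (hzero : ∀ᶠ s in 𝓝[>] (0 : ℝ), 0 ≤ h s)
    {c : ℝ} (hc : 0 < c) (htop : ∀ᶠ s in atTop, h s ≤ -c) :
    IntegrableOn (fun X : ℝ => Real.exp (2 * ∫ s in x₀..X, h s)) (Set.Ioi 0) := by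
  have hint : ∀ a b : ℝ, 0 < a → 0 < b → IntervalIntegrable h volume a b := fun a b ha hb =>
    (hcont.mono fun x hx => lt_of_lt_of_le (lt_min ha hb) hx.1).intervalIntegrable
  have hadd : ∀ a b : ℝ, 0 < a → 0 < b →
      (∫ s in x₀..b, h s) = (∫ s in x₀..a, h s) + ∫ s in a..b, h s := fun a b ha hb =>
    (integral_add_adjacent_intervals (hint _ _ hx₀ ha) (hint _ _ ha hb)).symm
  have hFcont : ContinuousOn (fun X : ℝ => Real.exp (2 * ∫ s in x₀..X, h s)) (Set.Ioi 0) := by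
    intro x hx
    have hd : HasDerivAt (fun X => ∫ s in x₀..X, h s) (h x) x :=
      integral_hasDerivAt_right (hint _ _ hx₀ hx)
        (hcont.stronglyMeasurableAtFilter isOpen_Ioi x hx)
        (hcont.continuousAt (Ioi_mem_nhds hx))
    exact (hd.continuousAt.const_mul 2).rexp.continuousWithinAt
  have hmeas : ∀ t ⊆ Set.Ioi (0 : ℝ), MeasurableSet t →
      AEStronglyMeasurable (fun X : ℝ => Real.exp (2 * ∫ s in x₀..X, h s)) (volume.restrict t) :=
    fun t ht hm => (hFcont.mono ht).aestronglyMeasurable hm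
  obtain ⟨δ, hδ, hδh⟩ := mem_nhdsGT_iff_exists_Ioc_subset.1 hzero
  have hδ : 0 < δ := hδ
  obtain ⟨R₀, hR₀⟩ := eventually_atTop.1 htop
  set R := max R₀ δ
  have hRpos : 0 < R := lt_of_lt_of_le hδ (le_max_right _ _)
  have hleft : IntegrableOn (fun X : ℝ => Real.exp (2 * ∫ s in x₀..X, h s)) (Set.Ioc 0 δ) := by
    have hdom : IntegrableOn (fun _ : ℝ => Real.exp (2 * ∫ s in x₀..δ, h s)) (Set.Ioc 0 δ) :=
      integrableOn_const (by simp)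
    refine hdom.mono' (hmeas _ Ioc_subset_Ioi_self measurableSet_Ioc) ?_
    refine (ae_restrict_mem measurableSet_Ioc).mono fun X hX => ?_
    rw [Real.norm_eq_abs, Real.abs_exp, Real.exp_le_exp, hadd X δ hX.1 hδ]
    have : 0 ≤ ∫ s in X..δ, h s :=
      integral_nonneg hX.2 fun s hs => hδh ⟨hX.1.trans_le hs.1, hs.2⟩
    linarith
  have hmid : IntegrableOn (fun X : ℝ => Real.exp (2 * ∫ s in x₀..X, h s)) (Set.Icc δ R) :=
    (hFcont.mono fun x hx => hδ.trans_le hx.1).integrableOn_Icc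
  have hright : IntegrableOn (fun X : ℝ => Real.exp (2 * ∫ s in x₀..X, h s)) (Set.Ioi R) := by
    have hdom : IntegrableOn (fun X : ℝ =>
        Real.exp (2 * (∫ s in x₀..R, h s) + 2 * c * R) * Real.exp (-(2 * c) * X)) (Set.Ioi R) :=
      (exp_neg_integrableOn_Ioi R (by positivity)).const_mul _
    refine hdom.mono' (hmeas _ (Ioi_subset_Ioi hRpos.le) measurableSet_Ioi) ?_
    refine (ae_restrict_mem measurableSet_Ioi).mono fun X hX => ?_
    have hX : R < X := hX
    rw [Real.norm_eq_abs, Real.abs_exp, ← Real.exp_add, Real.exp_le_exp,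
      hadd R X hRpos (hRpos.trans hX)]
    have : (∫ s in R..X, h s) ≤ ∫ _ in R..X, -c :=
      integral_mono_on hX.le (hint _ _ hRpos (hRpos.trans hX)) intervalIntegrable_const
        fun s hs => hR₀ s ((le_max_left _ _).trans hs.1)
    rw [intervalIntegral.integral_const, smul_eq_mul] at this
    linarith
  refine ((hleft.union hmid).union hright).mono_set fun x hx => ?_
  rcases le_or_gt x δ with h1 | h1
  · exact Or.inl (Or.inl ⟨hx, h1⟩)
  · rcases le_or_gt x R with h2 | h2
    · exact Or.inl (Or.inr ⟨h1.le, h2⟩)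
    · exact Or.inr h2

/-- The Köhler drift is nonnegative near `0`. -/
lemma kohler_drift_eventually_nonneg {a b β α lam : ℝ} (hb : 0 < b) (hα : 0 < α) :
    ∀ᶠ s in 𝓝[>] (0 : ℝ),
      0 ≤ lam - (a * s ^ (-(1 : ℝ) / 2) - b * s ^ (-(3 : ℝ) / 2)) + -β * s ^ α := by
  have hlim : ContinuousAt (fun s : ℝ =>
      lam * s ^ ((3 : ℝ) / 2) - a * s + b - β * s ^ (α + 3 / 2)) 0 := by
    have h1 := Real.continuousAt_rpow_const (0 : ℝ) ((3 : ℝ) / 2) (Or.inr (by norm_num))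
    have h2 := Real.continuousAt_rpow_const (0 : ℝ) (α + 3 / 2) (Or.inr (by positivity))
    fun_prop
  have hpos : ∀ᶠ s in 𝓝 (0 : ℝ),
      0 < lam * s ^ ((3 : ℝ) / 2) - a * s + b - β * s ^ (α + 3 / 2) := by
    refine hlim.eventually (lt_mem_nhds ?_)
    have hα' : α + 3 / 2 ≠ 0 := by positivity
    simpa [Real.zero_rpow hα'] using hb
  filter_upwards [hpos.filter_mono nhdsWithin_le_nhds, self_mem_nhdsWithin] with s hs hs0
  have hs0 : 0 < s := hs0
  have e1 : s ^ (-(3 : ℝ) / 2) * s ^ ((3 : ℝ) / 2) = 1 := by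
    rw [← Real.rpow_add hs0]; norm_num
  have e2 : s ^ (-(3 : ℝ) / 2) * s = s ^ (-(1 : ℝ) / 2) := by
    rw [← Real.rpow_add_one hs0.ne']; norm_num
  have e3 : s ^ (-(3 : ℝ) / 2) * s ^ (α + 3 / 2) = s ^ α := by
    rw [← Real.rpow_add hs0]; congr 1; ring
  have key := mul_nonneg (Real.rpow_nonneg hs0.le (-(3 : ℝ) / 2)) hs.le
  linear_combination key + lam * e1 - a * e2 - β * e3

/-- The Köhler drift with a sink tends to `-∞` at `∞`. -/
lemma kohler_drift_tendsto_atBot {a b β α lam : ℝ} (hβ : 0 < β) (hα : 0 < α) :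
    Tendsto (fun s : ℝ => lam - (a * s ^ (-(1 : ℝ) / 2) - b * s ^ (-(3 : ℝ) / 2)) + -β * s ^ α)
      atTop atBot := by
  have h1 : Tendsto (fun s : ℝ => s ^ (-(1 : ℝ) / 2)) atTop (𝓝 0) := by
    simpa only [neg_div] using tendsto_rpow_neg_atTop (y := (1 : ℝ) / 2) (by norm_num)
  have h3 : Tendsto (fun s : ℝ => s ^ (-(3 : ℝ) / 2)) atTop (𝓝 0) := by
    simpa only [neg_div] using tendsto_rpow_neg_atTop (y := (3 : ℝ) / 2) (by norm_num)
  exact (((h1.const_mul a).sub (h3.const_mul b)).const_sub lam).add_atBot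
    ((tendsto_rpow_atTop hα).const_mul_atTop_of_neg (neg_lt_zero.2 hβ))

/-- Normalizability of the Gibbs state for the M-Köhler model with bounded
state-dependent noise: let `f(X) = Ã·X^{-1/2} − B̃·X^{-3/2}`, `g(X) = −β·X^α` with
`β > 0` and `α > 0`, `λ ∈ ℝ`, fix `x₀ > 0`, and let `σ : (0,∞) → ℝ` be continuous with
`0 < σ₁ ≤ σ(X) ≤ σ₂` for all `X > 0` and some constants `σ₁, σ₂`. Then the Gibbs density
`ρ_λ(X) = σ(X)^{-2} · exp(2∫_{x₀}^X (λ − f(s) + g(s))/σ(s)² ds)` is integrable on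
`(0,∞)`, so the normalizing constant `Z_λ` is finite. -/
theorem gibbs_state_normalizable
    (A B D β α lam x₀ σ₁ σ₂ : ℝ) (hA : 0 < A) (hB : 0 < B) (hD : 0 < D)
    (hβ : 0 < β) (hα : 0 < α) (hx₀ : 0 < x₀)
    (Atil Btil : ℝ)
    (hAtil : Atil = A / (2 * D) ^ ((1 : ℝ) / 2))
    (hBtil : Btil = B / (2 * D) ^ ((3 : ℝ) / 2))
    (f g : ℝ → ℝ)
    (hf : ∀ X : ℝ, f X = Atil * X ^ (-(1 : ℝ) / 2) - Btil * X ^ (-(3 : ℝ) / 2))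
    (hg : ∀ X : ℝ, g X = -β * X ^ α)
    (σ : ℝ → ℝ)
    (hσcont : ContinuousOn σ (Set.Ioi 0))
    (hσ₁ : 0 < σ₁)
    (hσbound : ∀ X : ℝ, 0 < X → σ₁ ≤ σ X ∧ σ X ≤ σ₂) :
    MeasureTheory.IntegrableOn
      (fun X : ℝ => (σ X ^ 2)⁻¹
        * Real.exp (2 * ∫ s in x₀..X, (lam - f s + g s) / σ s ^ 2))
      (Set.Ioi 0) := by
  have hBpos : 0 < Btil := by rw [hBtil]; positivity
  have hσpos : ∀ X : ℝ, 0 < X → 0 < σ X := fun X hX => hσ₁.trans_le (hσbound X hX).1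
  have hσ₂ : 0 < σ₂ := (hσpos 1 one_pos).trans_le (hσbound 1 one_pos).2
  have hσne : ∀ X ∈ Set.Ioi (0 : ℝ), σ X ^ 2 ≠ 0 := fun X hX => (pow_pos (hσpos X hX) 2).ne'
  simp only [hf, hg]
  have hcont : ContinuousOn (fun s : ℝ => (lam - (Atil * s ^ (-(1 : ℝ) / 2) -
      Btil * s ^ (-(3 : ℝ) / 2)) + -β * s ^ α) / σ s ^ 2) (Set.Ioi 0) := by
    have hr : ∀ p : ℝ, ContinuousOn (fun s : ℝ => s ^ p) (Set.Ioi 0) := fun p =>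
      continuousOn_id.rpow_const fun s hs => Or.inl (ne_of_gt hs)
    exact (((continuousOn_const.sub ((continuousOn_const.mul (hr _)).sub
      (continuousOn_const.mul (hr _)))).add (continuousOn_const.mul (hr _)))).div
      (hσcont.pow 2) hσne
  have hexp := integrableOn_exp_two_mul_primitive hx₀ hcont
    (c := 1 / σ₂ ^ 2) ?_ (by positivity) ?_
  · refine hexp.bdd_mul (c := (σ₁ ^ 2)⁻¹)
      (((hσcont.pow 2).inv₀ hσne).aestronglyMeasurable measurableSet_Ioi) ?_
    refine (ae_restrict_mem measurableSet_Ioi).mono fun X hX => ?_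
    rw [Real.norm_of_nonneg (by positivity)]
    have := (hσbound X hX).1
    gcongr
  · filter_upwards [kohler_drift_eventually_nonneg hBpos hα] with s hs
    exact div_nonneg hs (sq_nonneg _)
  · filter_upwards [(kohler_drift_tendsto_atBot hβ hα).eventually_le_atBot (-1),
      eventually_gt_atTop 0] with s hs hs0
    have hσs := hσpos s hs0
    have hle : 1 / σ₂ ^ 2 ≤ 1 / σ s ^ 2 := by
      have := (hσbound s hs0).2
      gcongr
    calc _ ≤ -1 / σ s ^ 2 := by gcongr
      _ ≤ -(1 / σ₂ ^ 2) := by rw [neg_div]; linarith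
end
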